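/- Let A ∈ ℝ^{m×ℓ} with rank(A) = ℓ (full column rank) and b ∈ ℝ^m. Consider the randomized Gauss–Seidel (RGS) algorithm for min_y ‖b − Ay‖₂: starting from any y^{(0)} ∈ ℝ^ℓ, at step k pick, independently of all previous choices, a column index j_k ∈ {1,…,ℓ} with probability ‖A_{:,j_k}‖₂²/‖A‖_F², and set y^{(k)} = y^{(k−1)} + ((A_{:,j_k})ᵀ(b − Ay^{(k−1)})/‖A_{:,j_k}‖₂²) e_{j_k} (only the j_k-th component changes). Then for every k ≥ 0, E[‖y^{(k)} − A†b‖₂²] ≤ α^k ‖A†‖₂² ‖A(y^{(0)} − A†b)‖₂², where α = 1 − σ_min²(A)/‖A‖_F², A† is the Moore–Penrose pseudoinverse of A, σ_min(A) its smallest nonzero singular value, and ‖A†‖₂ the spectral norm of A†. -/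

import Mathlib

open Finset

noncomputable section

/-- Euclidean inner product on `ℝ^k`. -/
def dotp {k : ℕ} (x y : Fin k → ℝ) : ℝ := ∑ i, x i * y i

/-- Squared Euclidean norm on `ℝ^k`. -/
def sqnorm {k : ℕ} (x : Fin k → ℝ) : ℝ := ∑ i, (x i) ^ 2


open Matrix

/-- Squared Frobenius norm of a matrix. -/
def frobSq {m l : ℕ} (A : Matrix (Fin m) (Fin l) ℝ) : ℝ := ∑ i, ∑ j, (A i j) ^ 2

/-- Square of the minimum singular value of a (full column rank) matrix. -/
def sminSq {m l : ℕ} (A : Matrix (Fin m) (Fin l) ℝ) : ℝ :=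
  sInf {c : ℝ | ∃ v : Fin l → ℝ, sqnorm v = 1 ∧ c = sqnorm (A.mulVec v)}

/-- Square of the spectral norm (2-norm) of a matrix. -/
def spectralSq {m l : ℕ} (M : Matrix (Fin m) (Fin l) ℝ) : ℝ :=
  sSup {c : ℝ | ∃ v : Fin l → ℝ, sqnorm v = 1 ∧ c = sqnorm (M.mulVec v)}

/-- `P` is the Moore–Penrose pseudoinverse of `A` (Penrose conditions). -/
def IsMoorePenrose {m l : ℕ} (A : Matrix (Fin m) (Fin l) ℝ)
    (P : Matrix (Fin l) (Fin m) ℝ) : Prop :=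
  A * P * A = A ∧ P * A * P = P ∧ (A * P)ᵀ = A * P ∧ (P * A)ᵀ = P * A

/-- One step of the randomized Gauss–Seidel algorithm for `min ‖b − Ay‖₂`:
only the `j`-th component of `y` changes. -/
def rgsStep {m l : ℕ} (A : Matrix (Fin m) (Fin l) ℝ) (b : Fin m → ℝ) (j : Fin l)
    (y : Fin l → ℝ) : Fin l → ℝ :=
  Function.update y j (y j + dotp (Aᵀ j) (b - A.mulVec y) / sqnorm (Aᵀ j))

/-- The RGS iterate obtained from `y0` by applying one step for each entry of the
list of column choices. -/
def rgsIter {m l : ℕ} (A : Matrix (Fin m) (Fin l) ℝ) (b : Fin m → ℝ) (y0 : Fin l → ℝ) :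
    List (Fin l) → (Fin l → ℝ)
  | [] => y0
  | j :: js => rgsStep A b j (rgsIter A b y0 js)

theorem sqnorm_eq_dotProduct {k : ℕ} (x : Fin k → ℝ) : sqnorm x = x ⬝ᵥ x := by
  simp only [sqnorm, dotProduct, sq]

theorem sqnorm_nonneg {k : ℕ} (x : Fin k → ℝ) : 0 ≤ sqnorm x :=
  Finset.sum_nonneg fun _ _ => sq_nonneg _

theorem eq_zero_of_sqnorm_eq_zero {k : ℕ} {x : Fin k → ℝ} (h : sqnorm x = 0) : x = 0 :=
  dotProduct_self_eq_zero.1 (by rwa [← sqnorm_eq_dotProduct])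

theorem sqnorm_smul {k : ℕ} (c : ℝ) (x : Fin k → ℝ) : sqnorm (c • x) = c ^ 2 * sqnorm x := by
  simp only [sqnorm, Pi.smul_apply, smul_eq_mul, mul_pow, Finset.mul_sum]

theorem sq_dotProduct_le {k : ℕ} (x y : Fin k → ℝ) : (x ⬝ᵥ y) ^ 2 ≤ sqnorm x * sqnorm y :=
  Finset.sum_mul_sq_le_sq_mul_sq _ _ _

theorem frobSq_nonneg {m l : ℕ} (A : Matrix (Fin m) (Fin l) ℝ) : 0 ≤ frobSq A :=
  Finset.sum_nonneg fun _ _ => sqnorm_nonneg _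

theorem sum_sqnorm_transpose {m l : ℕ} (A : Matrix (Fin m) (Fin l) ℝ) :
    ∑ j, sqnorm (Aᵀ j) = frobSq A :=
  Finset.sum_comm

theorem sqnorm_mulVec_le {m l : ℕ} (A : Matrix (Fin m) (Fin l) ℝ) (v : Fin l → ℝ) :
    sqnorm (A *ᵥ v) ≤ frobSq A * sqnorm v := by
  rw [frobSq, Finset.sum_mul]
  exact Finset.sum_le_sum fun i _ => sq_dotProduct_le (A i) v

theorem sqnorm_normalize {k : ℕ} {v : Fin k → ℝ} (hv : 0 < sqnorm v) :
    sqnorm ((√(sqnorm v))⁻¹ • v) = 1 := by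
  rw [sqnorm_smul, inv_pow, Real.sq_sqrt hv.le, inv_mul_cancel₀ hv.ne']

theorem sqnorm_mulVec_normalize {m l : ℕ} (A : Matrix (Fin m) (Fin l) ℝ) (v : Fin l → ℝ) :
    sqnorm (A *ᵥ ((√(sqnorm v))⁻¹ • v)) = sqnorm (A *ᵥ v) / sqnorm v := by
  rw [mulVec_smul, sqnorm_smul, inv_pow, Real.sq_sqrt (sqnorm_nonneg v), div_eq_inv_mul]

theorem spectralSq_nonneg {m l : ℕ} (M : Matrix (Fin m) (Fin l) ℝ) : 0 ≤ spectralSq M := by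
  apply Real.sSup_nonneg
  rintro _ ⟨v, -, rfl⟩
  exact sqnorm_nonneg _

theorem sqnorm_mulVec_le_spectralSq {m l : ℕ} (M : Matrix (Fin m) (Fin l) ℝ) (v : Fin l → ℝ) :
    sqnorm (M *ᵥ v) ≤ spectralSq M * sqnorm v := by
  rcases (sqnorm_nonneg v).eq_or_lt with h | h
  · have := sqnorm_mulVec_le M v
    rwa [← h, mul_zero] at this ⊢
  · rw [← div_le_iff₀ h]
    refine le_csSup ⟨frobSq M, ?_⟩ ⟨_, sqnorm_normalize h, (sqnorm_mulVec_normalize M v).symm⟩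
    rintro _ ⟨w, hw, rfl⟩
    simpa [hw] using sqnorm_mulVec_le M w

theorem sminSq_mul_sqnorm_le {m l : ℕ} (A : Matrix (Fin m) (Fin l) ℝ) (v : Fin l → ℝ) :
    sminSq A * sqnorm v ≤ sqnorm (A *ᵥ v) := by
  rcases (sqnorm_nonneg v).eq_or_lt with h | h
  · rw [← h, mul_zero]
    exact sqnorm_nonneg _
  · rw [← le_div_iff₀ h]
    refine csInf_le ⟨0, ?_⟩ ⟨_, sqnorm_normalize h, (sqnorm_mulVec_normalize A v).symm⟩
    rintro _ ⟨w, -, rfl⟩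
    exact sqnorm_nonneg _

/-- On the range of `A`, the transpose expands squared norms by at least `sminSq A`. -/
theorem sminSq_mul_sqnorm_mulVec_le {m l : ℕ} (A : Matrix (Fin m) (Fin l) ℝ) (v : Fin l → ℝ) :
    sminSq A * sqnorm (A *ᵥ v) ≤ sqnorm (Aᵀ *ᵥ (A *ᵥ v)) := by
  rcases (sqnorm_nonneg (A *ᵥ v)).eq_or_lt with h | h
  · rw [← h, mul_zero]
    exact sqnorm_nonneg _
  · have hdot : (Aᵀ *ᵥ (A *ᵥ v)) ⬝ᵥ v = sqnorm (A *ᵥ v) := by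
      rw [mulVec_transpose, ← dotProduct_mulVec, sqnorm_eq_dotProduct]
    have hcs := sq_dotProduct_le (Aᵀ *ᵥ (A *ᵥ v)) v
    rw [hdot] at hcs
    have hmin := sminSq_mul_sqnorm_le A v
    have hv : 0 < sqnorm v := by
      refine (sqnorm_nonneg v).lt_of_ne fun h0 => ?_
      rw [← h0, mul_zero] at hcs
      exact absurd hcs (not_le.2 (by positivity))
    refine le_of_mul_le_mul_right ?_ hv
    nlinarith

theorem rgsStep_eq_add_single {m l : ℕ} (A : Matrix (Fin m) (Fin l) ℝ) (b : Fin m → ℝ)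
    (j : Fin l) (y : Fin l → ℝ) :
    rgsStep A b j y = y + Pi.single j (Aᵀ j ⬝ᵥ (b - A *ᵥ y) / sqnorm (Aᵀ j)) := by
  ext i
  by_cases h : i = j
  · subst h
    simp [rgsStep, dotp, dotProduct]
  · simp [rgsStep, h]

/-- The residual after one step, weighted by the squared norm of the chosen column. -/
theorem sqnorm_mul_sqnorm_mulVec_rgsStep_sub {m l : ℕ} (A : Matrix (Fin m) (Fin l) ℝ)
    (b : Fin m → ℝ) (x : Fin l → ℝ) (hx : Aᵀ *ᵥ (b - A *ᵥ x) = 0) (j : Fin l)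
    (y : Fin l → ℝ) :
    sqnorm (Aᵀ j) * sqnorm (A *ᵥ (rgsStep A b j y - x)) =
      sqnorm (Aᵀ j) * sqnorm (A *ᵥ (y - x)) - ((Aᵀ *ᵥ (A *ᵥ (y - x))) j) ^ 2 := by
  set a := Aᵀ j with ha
  set z := A *ᵥ (y - x) with hz
  have hres : a ⬝ᵥ (b - A *ᵥ y) = -(a ⬝ᵥ z) := by
    have h0 : a ⬝ᵥ (b - A *ᵥ x) = 0 := congrFun hx j
    have : b - A *ᵥ y = (b - A *ᵥ x) - z := by
      rw [hz, mulVec_sub]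
      abel
    rw [this, dotProduct_sub, h0, zero_sub]
  have hstep : A *ᵥ (rgsStep A b j y - x) = z + (-(a ⬝ᵥ z) / sqnorm a) • a := by
    rw [rgsStep_eq_add_single, ← ha, hres, add_sub_right_comm, mulVec_add, mulVec_single,
      op_smul_eq_smul]
    rfl
  have hcoord : (Aᵀ *ᵥ z) j = a ⬝ᵥ z := rfl
  rw [hstep, hcoord]
  by_cases h : sqnorm a = 0
  · simp [eq_zero_of_sqnorm_eq_zero h]
  · have hexp : ∀ c : ℝ, sqnorm (z + c • a) =
        sqnorm z + 2 * c * (a ⬝ᵥ z) + c ^ 2 * sqnorm a := by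
      intro c
      simp only [sqnorm_eq_dotProduct, add_dotProduct, dotProduct_add, smul_dotProduct,
        dotProduct_smul, smul_eq_mul, dotProduct_comm z a]
      ring
    rw [hexp]
    field_simp
    ring

/-- One step contracts the expected squared residual. -/
theorem sum_sqnorm_mulVec_rgsStep_sub_le {m l : ℕ} (A : Matrix (Fin m) (Fin l) ℝ)
    (b : Fin m → ℝ) (x : Fin l → ℝ) (hx : Aᵀ *ᵥ (b - A *ᵥ x) = 0) (y : Fin l → ℝ) :
    ∑ j, sqnorm (Aᵀ j) / frobSq A * sqnorm (A *ᵥ (rgsStep A b j y - x)) ≤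
      (1 - sminSq A / frobSq A) * sqnorm (A *ᵥ (y - x)) := by
  rcases (frobSq_nonneg A).eq_or_lt with h | h
  · simpa [← h] using sqnorm_nonneg (A *ᵥ (y - x))
  · have hsum : ∑ j, sqnorm (Aᵀ j) / frobSq A * sqnorm (A *ᵥ (rgsStep A b j y - x)) =
        (frobSq A * sqnorm (A *ᵥ (y - x)) - sqnorm (Aᵀ *ᵥ (A *ᵥ (y - x)))) / frobSq A := by
      simp only [div_mul_eq_mul_div, sqnorm_mul_sqnorm_mulVec_rgsStep_sub A b x hx]
      rw [← Finset.sum_div, Finset.sum_sub_distrib, ← Finset.sum_mul, sum_sqnorm_transpose]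
      rfl
    rw [hsum, div_le_iff₀ h]
    have := sminSq_mul_sqnorm_mulVec_le A (y - x)
    have hF : (1 - sminSq A / frobSq A) * sqnorm (A *ᵥ (y - x)) * frobSq A =
        frobSq A * sqnorm (A *ᵥ (y - x)) - sminSq A * sqnorm (A *ᵥ (y - x)) := by
      field_simp
    linarith

theorem sqnorm_div_frobSq_nonneg {m l : ℕ} (A : Matrix (Fin m) (Fin l) ℝ) (j : Fin l) :
    0 ≤ sqnorm (Aᵀ j) / frobSq A :=
  div_nonneg (sqnorm_nonneg _) (frobSq_nonneg A)

theorem sminSq_le_frobSq {m l : ℕ} (A : Matrix (Fin m) (Fin l) ℝ) : sminSq A ≤ frobSq A := by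
  rcases Set.eq_empty_or_nonempty
    {c : ℝ | ∃ v : Fin l → ℝ, sqnorm v = 1 ∧ c = sqnorm (A.mulVec v)} with h | ⟨_, v, hv, -⟩
  · rw [sminSq, h, Real.sInf_empty]
    exact frobSq_nonneg A
  · simpa [hv] using (sminSq_mul_sqnorm_le A v).trans (sqnorm_mulVec_le A v)

/-- The expected squared residual of the iterates decays geometrically. -/
theorem sum_sqnorm_mulVec_rgsIter_sub_le {m l : ℕ} (A : Matrix (Fin m) (Fin l) ℝ)
    (b : Fin m → ℝ) (x : Fin l → ℝ) (hx : Aᵀ *ᵥ (b - A *ᵥ x) = 0) (y0 : Fin l → ℝ) (k : ℕ) :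
    ∑ s : Fin k → Fin l, (∏ t, sqnorm (Aᵀ (s t)) / frobSq A) *
        sqnorm (A *ᵥ (rgsIter A b y0 (List.ofFn s) - x)) ≤
      (1 - sminSq A / frobSq A) ^ k * sqnorm (A *ᵥ (y0 - x)) := by
  induction k with
  | zero => simp [rgsIter]
  | succ k ih =>
    rw [← (Fin.consEquiv fun _ : Fin (k + 1) => Fin l).sum_comp, Fintype.sum_prod_type_right,
      pow_succ', mul_assoc]
    refine le_trans ?_ (mul_le_mul_of_nonneg_left ih
      (sub_nonneg.2 (div_le_one_of_le₀ (sminSq_le_frobSq A) (frobSq_nonneg A))))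
    rw [Finset.mul_sum]
    refine Finset.sum_le_sum fun s _ => ?_
    have hstep := mul_le_mul_of_nonneg_left
      (sum_sqnorm_mulVec_rgsStep_sub_le A b x hx (rgsIter A b y0 (List.ofFn s)))
      (Finset.prod_nonneg fun t (_ : t ∈ Finset.univ) => sqnorm_div_frobSq_nonneg A (s t))
    rw [Finset.mul_sum, mul_left_comm] at hstep
    refine le_of_eq_of_le (Finset.sum_congr rfl fun j _ => ?_) hstep
    simp only [Fin.consEquiv_apply, Fin.prod_univ_succ, List.ofFn_succ, Fin.cons_zero,
      Fin.cons_succ, rgsIter]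
    ring

theorem IsMoorePenrose.transpose_mulVec_sub {m l : ℕ} {A : Matrix (Fin m) (Fin l) ℝ}
    {P : Matrix (Fin l) (Fin m) ℝ} (h : IsMoorePenrose A P) (b : Fin m → ℝ) :
    Aᵀ *ᵥ (b - A *ᵥ (P *ᵥ b)) = 0 := by
  have hAP : Aᵀ * (A * P) = Aᵀ := by
    rw [← h.2.2.1, ← transpose_mul, h.1]
  rw [mulVec_sub, mulVec_mulVec, mulVec_mulVec, Matrix.mul_assoc, hAP, sub_self]

theorem IsMoorePenrose.mul_eq_one {m l : ℕ} {A : Matrix (Fin m) (Fin l) ℝ}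
    {P : Matrix (Fin l) (Fin m) ℝ} (h : IsMoorePenrose A P) (hA : A.rank = l) : P * A = 1 := by
  have hinj : Function.Injective A.mulVec := by
    rw [mulVec_injective_iff, linearIndependent_iff_card_eq_finrank_span, Set.finrank,
      ← rank_eq_finrank_span_cols, hA, Fintype.card_fin]
  refine ext_of_mulVec_single fun j => hinj ?_
  rw [mulVec_mulVec, ← Matrix.mul_assoc, h.1, one_mulVec]

/-- Convergence of randomized Gauss–Seidel for a full column
rank matrix: `E[‖y^{(k)} − A†b‖₂²] ≤ α^k ‖A†‖₂² ‖A(y⁰ − A†b)‖₂²` with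
`α = 1 − σ_min²(A)/‖A‖_F²`, where the `k`-th iterate is a function of the `k`
independent column choices `s : Fin k → Fin l` (column `j` being chosen with
probability `‖A_{:,j}‖₂²/‖A‖_F²`). -/
theorem rgs_convergence {m l : ℕ}
    (A : Matrix (Fin m) (Fin l) ℝ) (b : Fin m → ℝ) (Adag : Matrix (Fin l) (Fin m) ℝ)
    (hA : A.rank = l) (hAdag : IsMoorePenrose A Adag)
    (y0 : Fin l → ℝ) (k : ℕ) :
    ∑ s : Fin k → Fin l,
        (∏ t, sqnorm (Aᵀ (s t)) / frobSq A) *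
          sqnorm (rgsIter A b y0 (List.ofFn s) - Adag.mulVec b)
      ≤ (1 - sminSq A / frobSq A) ^ k * spectralSq Adag *
          sqnorm (A.mulVec (y0 - Adag.mulVec b)) := by
  have hPA : ∀ v, sqnorm v ≤ spectralSq Adag * sqnorm (A *ᵥ v) := fun v => by
    simpa [hAdag.mul_eq_one hA] using sqnorm_mulVec_le_spectralSq Adag (A *ᵥ v)
  have hres := mul_le_mul_of_nonneg_left
    (sum_sqnorm_mulVec_rgsIter_sub_le A b (Adag *ᵥ b) (hAdag.transpose_mulVec_sub b) y0 k)
    (spectralSq_nonneg Adag)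
  rw [mul_left_comm, ← mul_assoc, Finset.mul_sum] at hres
  refine le_trans (Finset.sum_le_sum fun s _ => ?_) hres
  rw [mul_left_comm]
  exact mul_le_mul_of_nonneg_left (hPA _)
    (Finset.prod_nonneg fun t _ => sqnorm_div_frobSq_nonneg A (s t))

end
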